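/- Let f ∈ ℝ[x₁,…,xₙ], let h, g be tuples of polynomials with feasible set K, and suppose f_min = inf_{x∈K} f(x) is finite. Let h^{rad} = (h^{rad}₁,…,h^{rad}_t) be a tuple of polynomials generating the vanishing ideal, with ⟨h^{rad}⟩ = I(V_ℝ(h)) = I(K). Then the Lasserre sequence {f_k} (using equalities h) has finite convergence to f_min if and only if the Lasserre sequence {f_k^{rad}} (using equalities h^{rad} in place of h, with the same g) has finite convergence to f_min. -/

import Mathlib

open MvPolynomial Pointwise

/-- A polynomial is a sum of squares. -/
def IsSOS {n : ℕ} (p : MvPolynomial (Fin n) ℝ) : Prop :=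
  ∃ (m : ℕ) (q : Fin m → MvPolynomial (Fin n) ℝ), p = ∑ i, q i ^ 2

/-- The `2k`-th truncated ideal generated by the tuple `h`. -/
def truncIdeal {n m : ℕ} (h : Fin m → MvPolynomial (Fin n) ℝ) (k : ℕ) :
    Set (MvPolynomial (Fin n) ℝ) :=
  {p | ∃ φ : Fin m → MvPolynomial (Fin n) ℝ,
    (∀ i, (φ i * h i).totalDegree ≤ 2 * k) ∧ p = ∑ i, φ i * h i}

/-- The `k`-th truncated quadratic module generated by the tuple `g` (with `g₀ = 1`). -/
def truncQM {n m : ℕ} (g : Fin m → MvPolynomial (Fin n) ℝ) (k : ℕ) :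
    Set (MvPolynomial (Fin n) ℝ) :=
  {p | ∃ σ : Fin (m + 1) → MvPolynomial (Fin n) ℝ,
    (∀ j, IsSOS (σ j) ∧
      (σ j * (Fin.cons 1 g : Fin (m + 1) → MvPolynomial (Fin n) ℝ) j).totalDegree ≤ 2 * k) ∧
    p = ∑ j, σ j * (Fin.cons 1 g : Fin (m + 1) → MvPolynomial (Fin n) ℝ) j}

/-- The feasible set `K` of the problem `h = 0, g ≥ 0`. -/
def feasSet {n m₁ m₂ : ℕ} (h : Fin m₁ → MvPolynomial (Fin n) ℝ)
    (g : Fin m₂ → MvPolynomial (Fin n) ℝ) : Set (Fin n → ℝ) :=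
  {x | (∀ i, eval x (h i) = 0) ∧ ∀ j, 0 ≤ eval x (g j)}

/-- The real variety `V_ℝ(h)`. -/
def realVariety {n m : ℕ} (h : Fin m → MvPolynomial (Fin n) ℝ) : Set (Fin n → ℝ) :=
  {x | ∀ i, eval x (h i) = 0}

/-- The vanishing ideal `I(S)` of a set `S ⊆ ℝⁿ`. -/
def vanishIdeal {n : ℕ} (S : Set (Fin n → ℝ)) : Set (MvPolynomial (Fin n) ℝ) :=
  {p | ∀ u ∈ S, eval u p = 0}

/-- The `k`-th Lasserre bound `f_k` (an extended real). -/
noncomputable def lasserreBound {n m₁ m₂ : ℕ} (f : MvPolynomial (Fin n) ℝ)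
    (h : Fin m₁ → MvPolynomial (Fin n) ℝ) (g : Fin m₂ → MvPolynomial (Fin n) ℝ)
    (k : ℕ) : EReal :=
  sSup {γ : EReal | ∃ r : ℝ, γ = (r : EReal) ∧ f - C r ∈ truncIdeal h k + truncQM g k}

/-- `f_min`, the infimum of `f` over `K`, as an extended real (`⊤` if `K = ∅`). -/
noncomputable def fMin {n : ℕ} (f : MvPolynomial (Fin n) ℝ) (K : Set (Fin n → ℝ)) : EReal :=
  ⨅ x ∈ K, (eval x f : EReal)


open scoped Polynomial

/-- The intermediate value property for polynomials over an ordered field. -/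
def PolyIVT (R : Type*) [Field R] [LinearOrder R] : Prop :=
  ∀ (q : R[X]) (a b : R), a < b → q.eval a * q.eval b < 0 →
    ∃ x, a < x ∧ x < b ∧ q.eval x = 0

section IntermediateValue

variable {R : Type*} [Field R] [LinearOrder R] [IsStrictOrderedRing R]

theorem PolyIVT.rolle_of_forall_ne_zero (hR : PolyIVT R) {q : R[X]} (hq : q ≠ 0) {a b : R}
    (hab : a < b) (ha : q.eval a = 0) (hb : q.eval b = 0)
    (hne : ∀ x, a < x → x < b → q.eval x ≠ 0) :
    ∃ x, a < x ∧ x < b ∧ q.derivative.eval x = 0 := by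
  obtain ⟨r, hr, hra⟩ := Polynomial.exists_eq_pow_rootMultiplicity_mul_and_not_dvd q hq a
  have hr0 : r ≠ 0 := by rintro rfl; simp at hra
  obtain ⟨s, hs, hsb⟩ := Polynomial.exists_eq_pow_rootMultiplicity_mul_and_not_dvd r hr0 b
  have hm : 0 < q.rootMultiplicity a := (Polynomial.rootMultiplicity_pos hq).2 ha
  have hrb : r.eval b = 0 := by
    have := hb
    rw [hr, Polynomial.eval_mul, mul_eq_zero] at this
    refine this.resolve_left ?_
    simp only [Polynomial.eval_pow, Polynomial.eval_sub, Polynomial.eval_X, Polynomial.eval_C]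
    exact pow_ne_zero _ (sub_ne_zero.2 hab.ne')
  have hn : 0 < r.rootMultiplicity b := (Polynomial.rootMultiplicity_pos hr0).2 hrb
  obtain ⟨m, hm⟩ := Nat.exists_eq_succ_of_ne_zero hm.ne'
  obtain ⟨n, hn⟩ := Nat.exists_eq_succ_of_ne_zero hn.ne'
  rw [hm] at hr
  rw [hn] at hs
  have hqs : q = (Polynomial.X - Polynomial.C a) ^ (m + 1) *
      ((Polynomial.X - Polynomial.C b) ^ (n + 1) * s) := by rw [← hs]; exact hr
  have hsa : s.eval a ≠ 0 := by
    intro h0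
    apply hra
    rw [Polynomial.dvd_iff_isRoot, Polynomial.IsRoot, hs, Polynomial.eval_mul, h0, mul_zero]
  have hsb : s.eval b ≠ 0 := fun h0 => hsb (Polynomial.dvd_iff_isRoot.2 h0)
  have hpos : 0 < s.eval a * s.eval b := by
    rcases lt_or_ge 0 (s.eval a * s.eval b) with h | h
    · exact h
    · obtain ⟨x, h1, h2, h3⟩ := hR s a b hab (lt_of_le_of_ne h (mul_ne_zero hsa hsb))
      exact absurd (by rw [hqs]; simp [h3]) (hne x h1 h2)
  let w : R[X] := Polynomial.C ((m : R) + 1) * ((Polynomial.X - Polynomial.C b) * s) +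
    Polynomial.C ((n : R) + 1) * ((Polynomial.X - Polynomial.C a) * s) +
    (Polynomial.X - Polynomial.C a) * (Polynomial.X - Polynomial.C b) * s.derivative
  have hder : q.derivative = (Polynomial.X - Polynomial.C a) ^ m *
      (Polynomial.X - Polynomial.C b) ^ n * w := by
    rw [hqs]
    simp only [w, Polynomial.derivative_mul, Polynomial.derivative_X_sub_C_pow,
      Nat.add_sub_cancel, map_add, map_natCast, map_one, Nat.cast_add, Nat.cast_one]
    ring
  have hwa : w.eval a = ((m : R) + 1) * ((a - b) * s.eval a) := by simp [w]
  have hwb : w.eval b = ((n : R) + 1) * ((b - a) * s.eval b) := by simp [w]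
  obtain ⟨x, h1, h2, h3⟩ := hR w a b hab (by
    rw [hwa, hwb]
    have h1 : (0 : R) < (m : R) + 1 := by positivity
    have h2 : (0 : R) < (n : R) + 1 := by positivity
    have h3 : 0 < b - a := sub_pos.2 hab
    have : 0 < (((m : R) + 1) * ((n : R) + 1)) * ((b - a) * (b - a)) *
      (s.eval a * s.eval b) := by positivity
    linear_combination this)
  exact ⟨x, h1, h2, by rw [hder]; simp [h3]⟩

theorem PolyIVT.rolle (hR : PolyIVT R) {q : R[X]} {a b : R}
    (hab : a < b) (ha : q.eval a = 0) (hb : q.eval b = 0) :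
    ∃ x, a < x ∧ x < b ∧ q.derivative.eval x = 0 := by
  rcases eq_or_ne q 0 with rfl | hq
  · obtain ⟨x, h1, h2⟩ := exists_between hab
    exact ⟨x, h1, h2, by simp⟩
  have hmem : b ∈ q.roots.toFinset.filter (a < ·) := by simp [hq, hb, hab]
  obtain ⟨c, hc, hmin⟩ := (q.roots.toFinset.filter (a < ·)).exists_min_image id ⟨b, hmem⟩
  simp only [Finset.mem_filter, Multiset.mem_toFinset, Polynomial.mem_roots hq,
    Polynomial.IsRoot, id] at hc hmin
  obtain ⟨x, h1, h2, h3⟩ := hR.rolle_of_forall_ne_zero hq hc.2 ha hc.1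
    (fun x h1 h2 h3 => (hmin x ⟨h3, h1⟩).not_gt h2)
  exact ⟨x, h1, h2.trans_le (hmin b ⟨hb, hab⟩), h3⟩

/-- A polynomial with a root in an interval on which its derivative has no root changes sign. -/
theorem PolyIVT.eval_mul_eval_neg (hR : PolyIVT R) {q : R[X]} {a x b : R} (hax : a < x)
    (hxb : x < b) (hx : q.eval x = 0)
    (hd : ∀ y, a < y → y < b → q.derivative.eval y ≠ 0) : q.eval a * q.eval b < 0 := by
  have hne : ∀ y, a ≤ y → y ≤ b → y ≠ x → q.eval y ≠ 0 := by
    intro y hay hyb hyx hy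
    rcases lt_or_gt_of_ne hyx with h | h
    · obtain ⟨z, h1, h2, h3⟩ := hR.rolle h hy hx
      exact hd z (hay.trans_lt h1) (h2.trans hxb) h3
    · obtain ⟨z, h1, h2, h3⟩ := hR.rolle h hx hy
      exact hd z (hax.trans h1) (h2.trans_le hyb) h3
  obtain ⟨r, rfl⟩ := Polynomial.dvd_iff_isRoot.2 hx
  have hrx : r.eval x ≠ 0 := by simpa [Polynomial.derivative_mul] using hd x hax hxb
  have hr : ∀ y, a ≤ y → y ≤ b → r.eval y ≠ 0 := by
    intro y hay hyb
    rcases eq_or_ne y x with rfl | h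
    · exact hrx
    · intro h0
      exact hne y hay hyb h (by simp [h0])
  have hab := hax.trans hxb
  have hpos : 0 < r.eval a * r.eval b := by
    by_contra h
    obtain ⟨y, h1, h2, h3⟩ := hR r a b hab
      (lt_of_le_of_ne (not_lt.1 h) (mul_ne_zero (hr a le_rfl hab.le) (hr b hab.le le_rfl)))
    exact hr y h1.le h2.le h3
  simp only [Polynomial.eval_mul, Polynomial.eval_sub, Polynomial.eval_X, Polynomial.eval_C]
  have := mul_pos (mul_pos (sub_pos.2 hax) (sub_pos.2 hxb)) hpos
  linear_combination this

theorem PolyIVT.sign_eval_eq (hR : PolyIVT R) {q : R[X]} {a b : R}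
    (h : ∀ x, min a b ≤ x → x ≤ max a b → q.eval x ≠ 0) :
    SignType.sign (q.eval a) = SignType.sign (q.eval b) := by
  wlog hab : a < b generalizing a b
  · rcases eq_or_lt_of_le (not_lt.1 hab) with rfl | h'
    · rfl
    · exact (this (fun x h1 h2 => h x (by rwa [min_comm]) (by rwa [max_comm])) h').symm
  rw [min_eq_left hab.le, max_eq_right hab.le] at h
  have ha := h a le_rfl hab.le
  have hb := h b hab.le le_rfl
  have hpos : 0 < q.eval a * q.eval b := by
    by_contra h0
    obtain ⟨y, h1, h2, h3⟩ := hR q a b hab (lt_of_le_of_ne (not_lt.1 h0) (mul_ne_zero ha hb))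
    exact h y h1.le h2.le h3
  rcases pos_and_pos_or_neg_and_neg_of_mul_pos hpos with ⟨h1, h2⟩ | ⟨h1, h2⟩
  · rw [sign_pos h1, sign_pos h2]
  · rw [sign_neg h1, sign_neg h2]

theorem Polynomial.Monic.abs_le_of_eval_eq_zero {q : R[X]} (hq : q.Monic) {a : R}
    (ha : q.eval a = 0) : |a| ≤ 1 + ∑ i ∈ Finset.range q.natDegree, |q.coeff i| := by
  by_contra! h
  set S := ∑ i ∈ Finset.range q.natDegree, |q.coeff i| with hS
  have hS0 : 0 ≤ S := Finset.sum_nonneg fun i _ => abs_nonneg _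
  have h1 : 1 ≤ |a| := by linarith
  rw [hq.as_sum] at ha
  simp only [Polynomial.eval_add, Polynomial.eval_pow, Polynomial.eval_X,
    Polynomial.eval_finsetSum, Polynomial.eval_mul, Polynomial.eval_C] at ha
  rcases Nat.eq_zero_or_pos q.natDegree with h0 | h0
  · rw [h0] at ha
    simp at ha
  obtain ⟨d, hd⟩ := Nat.exists_eq_succ_of_ne_zero h0.ne'
  have key : |a| ^ q.natDegree ≤ S * |a| ^ d := by
    rw [← abs_pow, eq_neg_of_add_eq_zero_left ha, abs_neg, hS, Finset.sum_mul]
    refine (Finset.abs_sum_le_sum_abs _ _).trans (Finset.sum_le_sum fun i hi => ?_)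
    rw [abs_mul, abs_pow]
    have := Finset.mem_range.1 hi
    gcongr
    omega
  rw [hd, Nat.succ_eq_add_one, pow_succ, mul_comm] at key
  have := le_of_mul_le_mul_right key (by positivity)
  linarith

end IntermediateValue

section RealMaximal

theorem isSumSq_list_sum {A : Type*} [Semiring A] (l : List A) :
    IsSumSq (l.map fun g => g * g).sum := by
  induction l with
  | nil => simp
  | cons a l ih => simpa using IsSumSq.sq_add a ih

theorem IsSumSq.exists_list {A : Type*} [Semiring A] {s : A} (hs : IsSumSq s) :
    ∃ l : List A, s = (l.map fun g => g * g).sum := by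
  induction hs with
  | zero => exact ⟨[], by simp⟩
  | sq_add a _ ih =>
    obtain ⟨l, rfl⟩ := ih
    exact ⟨a :: l, by simp⟩

theorem IsSumSq.map_ringHom {A B : Type*} [Semiring A] [Semiring B] (φ : A →+* B) {s : A}
    (hs : IsSumSq s) : IsSumSq (φ s) := by
  induction hs with
  | zero => simp
  | sq_add a _ ih => simpa using IsSumSq.sq_add (φ a) ih

theorem Polynomial.natDegree_list_sum_mul_self_le {A : Type*} [Semiring A] (l : List A[X])
    {d : ℕ} (hl : ∀ g ∈ l, g.natDegree ≤ d) :
    (l.map fun g => g * g).sum.natDegree ≤ 2 * d := by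
  induction l with
  | nil => simp
  | cons g l ih =>
    rw [List.map_cons, List.sum_cons]
    refine (Polynomial.natDegree_add_le _ _).trans (max_le ?_ ?_)
    · have := hl g List.mem_cons_self
      have := Polynomial.natDegree_mul_le (p := g) (q := g)
      omega
    · exact ih fun g hg => hl g (List.mem_cons_of_mem _ hg)

/-- No root of an irreducible polynomial of degree at least two can be adjoined to the field `R`
without making `-1` a sum of squares. -/
def IsRealMaximal (R : Type*) [Field R] : Prop :=
  ∀ f : R[X], Irreducible f → 2 ≤ f.natDegree →
    ∃ l : List R[X], (∀ g ∈ l, g.natDegree < f.natDegree) ∧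
      f ∣ 1 + (l.map fun g => g * g).sum

variable {R : Type*} [Field R]

theorem exists_list_sum_mul_self_of_natDegree_lt_two (l : List R[X])
    (hl : ∀ g ∈ l, g.natDegree < 2) :
    ∃ b d c : R, IsSumSq b ∧ IsSumSq c ∧ (l.map fun g => g * g).sum =
      Polynomial.C b + Polynomial.C d * Polynomial.X + Polynomial.C c * Polynomial.X ^ 2 := by
  induction l with
  | nil => exact ⟨0, 0, 0, by simp, by simp, by simp⟩
  | cons g l ih =>
    obtain ⟨b, d, c, hb, hc, hs⟩ := ih fun g hg => hl g (List.mem_cons_of_mem _ hg)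
    obtain ⟨u, v, rfl⟩ := Polynomial.exists_eq_X_add_C_of_natDegree_le_one
      (Nat.lt_succ_iff.1 (hl g List.mem_cons_self))
    refine ⟨v * v + b, 2 * u * v + d, u * u + c, hb.sq_add v, hc.sq_add u, ?_⟩
    rw [List.map_cons, List.sum_cons, hs]
    simp only [map_add, map_mul, map_ofNat]
    ring

theorem IsRealMaximal.isSumSq_or_isSumSq_neg [IsSemireal R] (hR : IsRealMaximal R) (a : R) :
    IsSumSq a ∨ IsSumSq (-a) := by
  by_cases ha : IsSquare a
  · exact .inl ha.isSumSq
  right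
  set f : R[X] := Polynomial.X ^ 2 - Polynomial.C a with hf
  have hdeg : f.natDegree = 2 := Polynomial.natDegree_X_pow_sub_C
  have hmonic : f.Monic := Polynomial.monic_X_pow_sub_C a two_ne_zero
  have hirr : Irreducible f := by
    rw [hmonic.irreducible_iff_roots_eq_zero_of_degree_le_three hdeg.ge (by omega)]
    refine Multiset.eq_zero_of_forall_notMem fun r hr => ha ⟨r, ?_⟩
    rw [Polynomial.mem_roots hmonic.ne_zero] at hr
    have : r ^ 2 - a = 0 := by simpa [hf] using hr
    linear_combination -this
  obtain ⟨l, hl, hdvd⟩ := hR f hirr hdeg.ge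
  obtain ⟨b, d, c, hb, hc, hs⟩ := exists_list_sum_mul_self_of_natDegree_lt_two l
    fun g hg => (hl g hg).trans_eq hdeg
  have hdvd' : f ∣ Polynomial.C d * Polynomial.X + Polynomial.C (1 + b + c * a) := by
    have : Polynomial.C d * Polynomial.X + Polynomial.C (1 + b + c * a) =
        1 + (l.map fun g => g * g).sum - f * Polynomial.C c := by
      rw [hs, hf]
      simp only [map_add, map_mul, map_one]
      ring
    rw [this]
    exact dvd_sub hdvd (dvd_mul_right _ _)
  have hzero := Polynomial.eq_zero_of_dvd_of_natDegree_lt hdvd'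
    (by rw [hdeg]; exact Nat.lt_succ_of_le Polynomial.natDegree_linear_le)
  have hrel : 1 + b + c * a = 0 := by
    simpa using congrArg (Polynomial.eval 0) hzero
  have hc0 : c ≠ 0 := by
    rintro rfl
    exact IsSemireal.one_add_ne_zero hb (by simpa using hrel)
  have : -a = (1 + b) * c * (c⁻¹ * c⁻¹) := by
    field_simp
    linear_combination -hrel
  rw [this]
  exact ((IsSumSq.one.add hb).mul hc).mul (IsSumSq.mul_self _)

theorem IsSemireal.eq_zero_of_isSumSq [IsSemireal R] {a : R} (h : IsSumSq a)
    (h' : IsSumSq (-a)) : a = 0 := by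
  by_contra ha
  refine IsSemireal.one_add_ne_zero ((h.mul h').mul (IsSumSq.mul_self a⁻¹)) ?_
  field_simp
  ring

open Classical in
theorem IsRealMaximal.exists_linearOrder [IsSemireal R] (hR : IsRealMaximal R) :
    ∃ _ : LinearOrder R, IsStrictOrderedRing R := by
  let o : LinearOrder R :=
    { le := fun a b => IsSumSq (b - a)
      le_refl := fun a => by simp
      le_trans := fun a b c hab hbc => by simpa using hbc.add hab
      le_antisymm := fun a b hab hba =>
        (sub_eq_zero.1 (IsSemireal.eq_zero_of_isSumSq hab (by simpa using hba))).symm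
      le_total := fun a b => by
        simpa using hR.isSumSq_or_isSumSq_neg (b - a)
      toDecidableLE := Classical.decRel _ }
  have hle : ∀ a b : R, a ≤ b ↔ IsSumSq (b - a) := fun _ _ => Iff.rfl
  have hadd : ∀ a b : R, a ≤ b → ∀ c, a + c ≤ b + c := fun a b h c => by
    rw [hle] at h ⊢
    simpa using h
  have : IsOrderedAddMonoid R := { add_le_add_left := hadd }
  have : ZeroLEOneClass R := ⟨by rw [hle]; simp⟩
  have : IsOrderedRing R := .of_mul_nonneg fun a b ha hb => by
    rw [hle, sub_zero] at *
    exact ha.mul hb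
  exact ⟨o, inferInstance⟩

variable [LinearOrder R] [IsStrictOrderedRing R]

theorem IsRealMaximal.polyIVT (hR : IsRealMaximal R) : PolyIVT R := by
  intro q
  induction hn : q.natDegree using Nat.strong_induction_on generalizing q with
  | _ n ih =>
  subst hn
  intro a b hab hq
  have hq0 : q ≠ 0 := by rintro rfl; simp at hq
  rcases Nat.lt_or_ge q.natDegree 2 with hlt | hge
  · obtain ⟨u, v, rfl⟩ := Polynomial.exists_eq_X_add_C_of_natDegree_le_one
      (Nat.lt_succ_iff.1 hlt)
    simp only [Polynomial.eval_add, Polynomial.eval_mul, Polynomial.eval_C,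
      Polynomial.eval_X] at hq ⊢
    have hu : u ≠ 0 := by
      rintro rfl
      have := mul_self_nonneg v
      simp only [zero_mul, zero_add] at hq
      linarith
    have hu2 : 0 < u * u := mul_self_pos.2 hu
    have hmul : (a - -v / u) * (b - -v / u) < 0 := by
      have : (u * a + v) * (u * b + v) = (u * u) * ((a - -v / u) * (b - -v / u)) := by
        field_simp
        ring
      rw [this] at hq
      exact (pos_iff_neg_of_mul_neg hq).1 hu2
    refine ⟨-v / u, ?_, ?_, by field_simp; ring⟩
    · rcases mul_neg_iff.1 hmul with h | h <;> linarith
    · rcases mul_neg_iff.1 hmul with h | h <;> linarith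
  by_cases hirr : Irreducible q
  · obtain ⟨l, hl, k, hk⟩ := hR q hirr hge
    have hpos : ∀ x, 0 < q.eval x * k.eval x := by
      intro x
      rw [← Polynomial.eval_mul, ← hk, Polynomial.eval_add, Polynomial.eval_one]
      have := ((isSumSq_list_sum l).map_ringHom (Polynomial.evalRingHom x)).nonneg
      rw [Polynomial.coe_evalRingHom] at this
      linarith
    have hk0 : k ≠ 0 := by
      rintro rfl
      simpa using hpos 0
    have hdeg : k.natDegree < q.natDegree := by
      have h1 : (q * k).natDegree ≤ 2 * (q.natDegree - 1) := by
        rw [← hk]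
        refine (Polynomial.natDegree_add_le _ _).trans (max_le (by simp) ?_)
        refine Polynomial.natDegree_list_sum_mul_self_le l fun g hg => ?_
        have := hl g hg
        omega
      rw [Polynomial.natDegree_mul hq0 hk0] at h1
      omega
    obtain ⟨x, -, -, hx⟩ := ih _ hdeg k rfl a b hab (by
      have h1 := mul_pos (hpos a) (hpos b)
      by_contra! h
      have := mul_nonpos_of_nonneg_of_nonpos h hq.le
      linarith)
    exact absurd (hpos x) (by simp [hx])
  · have hnu : ¬ IsUnit q := fun h => by
      have := Polynomial.natDegree_eq_zero_of_isUnit h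
      omega
    obtain ⟨u, v, huv⟩ : ∃ u v, ∃ (_ : ¬ IsUnit u) (_ : ¬ IsUnit v), q = u * v := by
      by_contra! h
      exact hirr ⟨hnu, fun u v huv => by
        by_contra! h'
        exact h u v h'.1 h'.2 huv⟩
    obtain ⟨hu, hv, rfl⟩ := huv
    have hu0 : u ≠ 0 := left_ne_zero_of_mul hq0
    have hv0 : v ≠ 0 := right_ne_zero_of_mul hq0
    have hdu : 0 < u.natDegree := Polynomial.natDegree_pos_iff_degree_pos.2
      (Polynomial.degree_pos_of_ne_zero_of_nonunit hu0 hu)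
    have hdv : 0 < v.natDegree := Polynomial.natDegree_pos_iff_degree_pos.2
      (Polynomial.degree_pos_of_ne_zero_of_nonunit hv0 hv)
    have hd := Polynomial.natDegree_mul hu0 hv0
    rcases lt_or_ge (u.eval a * u.eval b) 0 with h | h
    · obtain ⟨x, h1, h2, h3⟩ := ih _ (by omega) u rfl a b hab h
      exact ⟨x, h1, h2, by simp [h3]⟩
    · obtain ⟨x, h1, h2, h3⟩ := ih _ (by omega) v rfl a b hab (by
        by_contra! h'
        have := mul_nonneg h h'
        simp only [Polynomial.eval_mul] at hq
        linarith)
      exact ⟨x, h1, h2, by simp [h3]⟩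

end RealMaximal

universe u

section RealPrime

variable {A : Type*} [CommRing A]

/-- The multiplicative set of the elements `p ^ (2 * l) + σ` with `σ` a sum of squares. -/
def evenPowAddSumSq (p : A) : Submonoid A where
  carrier := {a | ∃ l σ, IsSumSq σ ∧ a = p ^ (2 * l) + σ}
  one_mem' := ⟨0, 0, .zero, by simp⟩
  mul_mem' := by
    rintro _ _ ⟨l, σ, hσ, rfl⟩ ⟨m, τ, hτ, rfl⟩
    have hp : ∀ l, IsSumSq (p ^ (2 * l)) := fun l => by
      rw [two_mul, pow_add]
      exact .mul_self _
    exact ⟨l + m, _, (((hp l).mul hτ).add (hσ.mul (hp m))).add (hσ.mul hτ), by ring⟩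

theorem add_mem_evenPowAddSumSq {p a σ : A} (ha : a ∈ evenPowAddSumSq p) (hσ : IsSumSq σ) :
    a + σ ∈ evenPowAddSumSq p := by
  obtain ⟨l, τ, hτ, rfl⟩ := ha
  exact ⟨l, τ + σ, hτ.add hσ, by ring⟩

theorem Ideal.exists_le_real_prime (I : Ideal A) (p : A)
    (hp : Disjoint (I : Set A) (evenPowAddSumSq p)) :
    ∃ J : Ideal A, J.IsPrime ∧ I ≤ J ∧ p ∉ J ∧
      ∀ a σ, IsSumSq σ → a * a + σ ∈ J → a ∈ J := by
  obtain ⟨J, hIJ, hJ⟩ := zorn_le_nonempty₀ {J : Ideal A | Disjoint (J : Set A) (evenPowAddSumSq p)}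
    (fun c hc hc' x hx => by
      refine ⟨sSup c, Set.disjoint_left.mpr fun y hy => ?_, fun _ => le_sSup⟩
      rw [SetLike.mem_coe, Submodule.mem_sSup_of_directed ⟨x, hx⟩ hc'.directedOn] at hy
      obtain ⟨J, hJ, hy⟩ := hy
      exact Set.disjoint_left.mp (hc hJ) hy) I hp
  have hpr := Ideal.isPrime_of_maximally_disjoint _ _ hJ.1 fun _ => hJ.not_prop_of_gt
  refine ⟨J, hpr, hIJ, fun hpJ => ?_, fun a σ hσ h => ?_⟩
  · exact Set.disjoint_left.mp hJ.1 (J.mul_mem_left p hpJ) ⟨1, 0, .zero, by ring⟩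
  · by_contra ha
    have hlt := hJ.not_prop_of_gt (Submodule.lt_sup_iff_notMem.mpr ha)
    simp only [Set.mem_ofPred_eq, Set.not_disjoint_iff, SetLike.mem_coe, Submodule.mem_sup,
      Submodule.mem_span_singleton] at hlt
    obtain ⟨t, ⟨j, hj, _, ⟨b, rfl⟩, rfl⟩, ht⟩ := hlt
    refine Set.disjoint_left.mp hJ.1 ?_ (add_mem_evenPowAddSumSq (mul_mem ht ht)
      (hσ.mul (IsSumSq.mul_self b)))
    have : (j + b • a) * (j + b • a) + σ * (b * b) =
        (j + 2 * b * a) * j + b * b * (a * a + σ) := by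
      rw [smul_eq_mul]
      ring
    rw [this]
    exact J.add_mem (J.mul_mem_left _ hj) (J.mul_mem_left _ h)

theorem isSemireal_fractionRing_quotient (J : Ideal A) [J.IsPrime]
    (hJ : ∀ a σ, IsSumSq σ → a * a + σ ∈ J → a ∈ J) : IsSemireal (FractionRing (A ⧸ J)) := by
  let φ : A →+* FractionRing (A ⧸ J) := (algebraMap (A ⧸ J) _).comp (Ideal.Quotient.mk J)
  have hφ : ∀ a, φ a = 0 ↔ a ∈ J := fun a => by
    rw [RingHom.comp_apply, IsFractionRing.to_map_eq_zero_iff, Ideal.Quotient.eq_zero_iff_mem]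
  have key : ∀ s, IsSumSq s → ∃ d τ, d ∉ J ∧ IsSumSq τ ∧ s * (φ d * φ d) = φ τ := by
    intro s hs
    induction hs with
    | zero => exact ⟨1, 0, (Ideal.ne_top_iff_one J).1 (Ideal.IsPrime.ne_top ‹_›), .zero, by simp⟩
    | @sq_add a s _ ih =>
      obtain ⟨d, τ, hd, hτ, h⟩ := ih
      obtain ⟨u', v', hv', rfl⟩ := IsFractionRing.div_surjective (A := A ⧸ J) a
      obtain ⟨u, rfl⟩ := Ideal.Quotient.mk_surjective u'
      obtain ⟨v, rfl⟩ := Ideal.Quotient.mk_surjective v'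
      have hv : v ∉ J := fun h => nonZeroDivisors.ne_zero hv' (Ideal.Quotient.eq_zero_iff_mem.2 h)
      have hv0 : φ v ≠ 0 := fun h => hv ((hφ v).1 h)
      refine ⟨v * d, (u * d) * (u * d) + τ * (v * v), fun h => ?_,
        (hτ.mul (.mul_self v)).sq_add _, ?_⟩
      · exact (Ideal.IsPrime.mem_or_mem ‹_› h).elim hv hd
      · change (φ u / φ v * (φ u / φ v) + s) * _ = _
        simp only [map_mul, map_add, ← h]
        field_simp
  refine ⟨fun {s} hs h => ?_⟩
  obtain ⟨d, τ, hd, hτ, h'⟩ := key s hs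
  refine hd (hJ d τ hτ ((hφ _).1 ?_))
  rw [map_add, map_mul, ← h']
  linear_combination (φ d * φ d) * h

end RealPrime

section RealClosure

variable {Ω : Type*} [Field Ω]

theorem isSemireal_subfield_iff {E : Subfield Ω} :
    IsSemireal E ↔ ∀ l : List Ω, (∀ y ∈ l, y ∈ E) → 1 + (l.map fun y => y * y).sum ≠ 0 := by
  constructor
  · intro h l hl h0
    lift l to List E using hl
    refine h.one_add_ne_zero (isSumSq_list_sum l) (E.subtype_injective ?_)
    rw [map_add, map_one, map_zero, ← h0, map_list_sum, List.map_map, List.map_map]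
    congr 2
  · refine fun h => ⟨fun hs h0 => ?_⟩
    obtain ⟨l, rfl⟩ := hs.exists_list
    refine h (l.map E.subtype) (by simp +contextual) ?_
    have := congrArg E.subtype h0
    rw [map_add, map_one, map_zero, map_list_sum, List.map_map] at this
    rw [← this, List.map_map]
    congr 3

theorem exists_isRealMaximal_subfield [IsAlgClosed Ω] (F : Subfield Ω) (hF : IsSemireal F) :
    ∃ E : Subfield Ω, F ≤ E ∧ IsSemireal E ∧ IsRealMaximal E := by
  obtain ⟨E, hFE, hE⟩ := zorn_le_nonempty₀ {E : Subfield Ω | IsSemireal E}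
    (fun c hc hc' x hx => by
      refine ⟨sSup c, ?_, fun _ => le_sSup⟩
      refine isSemireal_subfield_iff.2 fun l hl => ?_
      have : ∃ E ∈ c, ∀ y ∈ l, y ∈ E := by
        clear! hF
        induction l with
        | nil => exact ⟨x, hx, by simp⟩
        | cons a l ih =>
          obtain ⟨E, hE, h1⟩ := ih fun y hy => hl y (List.mem_cons_of_mem _ hy)
          obtain ⟨E', hE', h2⟩ := (Subfield.mem_sSup_of_directedOn ⟨x, hx⟩ hc'.directedOn).1
            (hl a List.mem_cons_self)
          obtain ⟨E'', hE'', h3, h4⟩ := hc'.directedOn E hE E' hE'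
          refine ⟨E'', hE'', fun y hy => ?_⟩
          rcases List.mem_cons.1 hy with rfl | hy
          · exact h4 h2
          · exact h3 (h1 y hy)
      obtain ⟨E, hE, h⟩ := this
      exact isSemireal_subfield_iff.1 (hc hE) l h) F hF
  refine ⟨E, hFE, hE.1, fun f hf hdeg => ?_⟩
  obtain ⟨ω, hω⟩ := IsAlgClosed.exists_aeval_eq_zero Ω f (by
    rw [Polynomial.degree_eq_natDegree hf.ne_zero]
    exact_mod_cast (by omega : f.natDegree ≠ 0))
  have halg : IsAlgebraic E ω := ⟨f, hf.ne_zero, hω⟩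
  have hlt : E < (IntermediateField.adjoin E {ω}).toSubfield := by
    refine SetLike.lt_iff_le_and_exists.2 ⟨fun y hy => ?_, ω, ?_, fun h => ?_⟩
    · exact (IntermediateField.adjoin E {ω}).algebraMap_mem ⟨y, hy⟩
    · exact IntermediateField.mem_adjoin_simple_self E ω
    · have h1 : f.eval (⟨ω, h⟩ : E) = 0 := by
        apply E.subtype_injective
        rw [map_zero, ← hω]
        exact (Polynomial.aeval_algebraMap_apply_eq_algebraMap_eval (A := Ω) (⟨ω, h⟩ : E) f).symm
      have : f.natDegree = 1 := Polynomial.natDegree_eq_of_degree_eq_some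
        (Polynomial.degree_eq_one_of_irreducible_of_root hf h1)
      omega
  have hnot : ¬ IsSemireal (IntermediateField.adjoin E {ω}).toSubfield := hE.not_prop_of_gt hlt
  rw [isSemireal_subfield_iff] at hnot
  push Not at hnot
  obtain ⟨l, hl, hsum⟩ := hnot
  have hrep : ∀ y ∈ l, ∃ g : E[X], g.natDegree < f.natDegree ∧ Polynomial.aeval ω g = y := by
    intro y hy
    have h1 : y ∈ (IntermediateField.adjoin E {ω}).toSubalgebra := hl y hy
    rw [IntermediateField.adjoin_simple_toSubalgebra_of_isAlgebraic halg,
      Algebra.adjoin_singleton_eq_range_aeval] at h1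
    obtain ⟨g, rfl⟩ := h1
    refine ⟨g % f, Polynomial.natDegree_mod_lt g (by omega), ?_⟩
    have := congrArg (Polynomial.aeval ω) (EuclideanDomain.div_add_mod g f)
    rw [map_add, map_mul, hω, zero_mul, zero_add] at this
    exact this
  choose! r hr1 hr2 using hrep
  refine ⟨l.map r, by simpa using hr1, ?_⟩
  have hmin : f ∣ minpoly E ω := by
    rw [← minpoly.eq_of_irreducible hf hω]
    exact dvd_mul_right _ _
  refine hmin.trans (minpoly.dvd E ω ?_)
  rw [map_add, map_one, map_list_sum, List.map_map, List.map_map, ← hsum]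
  congr 2
  refine List.map_congr_left fun y hy => ?_
  simp [hr2 y hy]

/-- The abstract part of the real Nullstellensatz: if no element `p ^ (2 * l) + σ` with `σ` a sum
of squares lies in `I`, then there is a homomorphism to an ordered field with the intermediate
value property for polynomials which kills `I` but not `p`. -/
theorem Ideal.exists_ringHom_polyIVT {A : Type u} [CommRing A] (I : Ideal A) (p : A)
    (hp : Disjoint (I : Set A) (evenPowAddSumSq p)) :
    ∃ (R : Type u) (_ : Field R) (_ : LinearOrder R) (_ : IsStrictOrderedRing R) (φ : A →+* R),
      PolyIVT R ∧ (∀ a ∈ I, φ a = 0) ∧ φ p ≠ 0 := by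
  obtain ⟨J, hJ, hIJ, hpJ, hreal⟩ := I.exists_le_real_prime p hp
  have hF := isSemireal_fractionRing_quotient J hreal
  let F := FractionRing (A ⧸ J)
  let ι : F →+* AlgebraicClosure F := algebraMap F (AlgebraicClosure F)
  have hF' : IsSemireal ι.fieldRange := by
    refine ⟨fun {s} hs h0 => ?_⟩
    let e : ι.fieldRange →+* F := ι.rangeRestrictFieldEquiv.symm
    refine hF.one_add_ne_zero (hs.map_ringHom e) ?_
    rw [← map_one e, ← map_add, h0, map_zero]
  obtain ⟨E, hE, hsr, hmax⟩ := exists_isRealMaximal_subfield ι.fieldRange hF'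
  obtain ⟨o, ho⟩ := hmax.exists_linearOrder
  let ψ : F →+* E := (Subfield.inclusion hE).comp ι.rangeRestrictField
  let φ : A →+* E := ψ.comp ((algebraMap (A ⧸ J) F).comp (Ideal.Quotient.mk J))
  have hφ : ∀ a, φ a = 0 ↔ a ∈ J := fun a => by
    rw [RingHom.comp_apply, map_eq_zero, RingHom.comp_apply,
      IsFractionRing.to_map_eq_zero_iff, Ideal.Quotient.eq_zero_iff_mem]
  exact ⟨E, inferInstance, o, ho, φ, hmax.polyIVT, fun a ha => (hφ a).2 (hIJ ha),
    fun h => hpJ ((hφ p).1 h)⟩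

end RealClosure

section OrderedEmbedding

set_option linter.unusedSectionVars false

variable {K R S : Type*} [Field K] [LinearOrder K] [IsStrictOrderedRing K]
  [Field R] [LinearOrder R] [IsStrictOrderedRing R]
  [Field S] [LinearOrder S] [IsStrictOrderedRing S]

theorem StrictMono.sign_map {i : K →+* R} (hi : StrictMono i) (a : K) :
    SignType.sign (i a) = SignType.sign a := by
  rcases lt_trichotomy a 0 with h | rfl | h
  · rw [sign_neg h, sign_neg (by simpa using hi h)]
  · simp
  · rw [sign_pos h, sign_pos (by simpa using hi h)]

/-- Away from the image of `K`, a point of an ordered extension can be approximated by an element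
of `K` which lies on the same side of finitely many prescribed elements of `K`. -/
theorem exists_same_side {i : K →+* R} (hi : StrictMono i) {α : R} (hα : α ∉ i.range) (Z : Finset K) :
    ∃ c : K, ∀ z ∈ Z, z ≠ c ∧ (z < c → i z < α) ∧ (c < z → α < i z) := by
  have hne : ∀ z, i z ≠ α := fun z h => hα ⟨z, h⟩
  obtain ⟨c, h1, h2⟩ := Order.exists_between_finsets (Z.filter fun z => i z < α)
    (Z.filter fun z => α < i z) fun x hx y hy =>
      hi.lt_iff_lt.1 ((Finset.mem_filter.1 hx).2.trans (Finset.mem_filter.1 hy).2)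
  refine ⟨c, fun z hz => ?_⟩
  rcases lt_or_gt_of_ne (hne z) with h | h
  · have := h1 z (by simp [hz, h])
    exact ⟨this.ne, fun _ => h, fun h' => absurd h' this.asymm⟩
  · have := h2 z (by simp [hz, h])
    exact ⟨this.ne', fun h' => absurd h' this.asymm, fun _ => h⟩

theorem PolyIVT.sign_eval_map_eq (hR : PolyIVT R) {i : K →+* R} (hi : StrictMono i) {α : R}
    {q : K[X]} (hq : q ≠ 0) (hroots : ∀ x, (q.map i).eval x = 0 → x ∈ i.range) {c : K}
    (hc : ∀ z ∈ q.roots.toFinset, z ≠ c ∧ (z < c → i z < α) ∧ (c < z → α < i z)) :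
    SignType.sign ((q.map i).eval α) = SignType.sign (q.eval c) := by
  rw [← hi.sign_map, ← Polynomial.eval_map_apply]
  refine hR.sign_eval_eq fun x h1 h2 hx => ?_
  obtain ⟨z, rfl⟩ := hroots x hx
  rw [Polynomial.eval_map_apply, map_eq_zero] at hx
  obtain ⟨hne, hlt, hgt⟩ := hc z (by simpa [hq] using hx)
  rcases lt_or_gt_of_ne hne with h | h
  · exact (lt_min (hlt h) (hi h)).not_ge h1
  · exact (max_lt (hgt h) (hi h)).not_ge h2

theorem exists_gap {i : K →+* R} (hi : StrictMono i) {α : R} (hα : α ∉ i.range) {q : K[X]}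
    (hq : q ≠ 0) (hroot : (q.map i).eval α = 0) (Z : Finset K) :
    ∃ z z' : K, i z < α ∧ α < i z' ∧ ∀ w ∈ Z, z < w → ¬ w < z' := by
  have hne : ∀ z, i z ≠ α := fun z h => hα ⟨z, h⟩
  set p := q * Polynomial.C q.leadingCoeff⁻¹
  have hp : p.Monic := Polynomial.monic_mul_leadingCoeff_inv hq
  obtain ⟨M, hM⟩ : ∃ M : K, |α| ≤ i M := by
    refine ⟨1 + ∑ j ∈ Finset.range p.natDegree, |p.coeff j|, ?_⟩
    have := (hp.map i).abs_le_of_eval_eq_zero (a := α) (by simp [p, hroot])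
    refine this.trans_eq ?_
    have habs : ∀ a : K, |i a| = i |a| := fun a => by
      rw [abs_eq_max_neg, abs_eq_max_neg, hi.monotone.map_max, map_neg]
    simp [habs, Polynomial.natDegree_map]
  rw [abs_le] at hM
  have hlo : -M ∈ insert (-M) (Z.filter fun z => i z < α) := by simp
  have hup : M ∈ insert M (Z.filter fun z => α < i z) := by simp
  refine ⟨Finset.max' _ ⟨_, hlo⟩, Finset.min' _ ⟨_, hup⟩, ?_, ?_, fun w hw h1 h2 => ?_⟩
  · rcases Finset.mem_insert.1 (Finset.max'_mem _ ⟨_, hlo⟩) with h | h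
    · rw [h]
      exact lt_of_le_of_ne (by simpa using hM.1) (hne _)
    · exact (Finset.mem_filter.1 h).2
  · rcases Finset.mem_insert.1 (Finset.min'_mem _ ⟨_, hup⟩) with h | h
    · rw [h]
      exact lt_of_le_of_ne hM.2 (hne _).symm
    · exact (Finset.mem_filter.1 h).2
  · rcases lt_or_gt_of_ne (hne w) with h | h
    · exact h1.not_ge (Finset.le_max' _ _ (by simp [hw, h]))
    · exact h2.not_ge (Finset.min'_le _ _ (by simp [hw, h]))

theorem derivative_ne_zero_of_eval_map_eq_zero {i : K →+* R} {α : R} {q : K[X]} (hq : q ≠ 0)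
    (hroot : (q.map i).eval α = 0) :
    q.derivative ≠ 0 ∧ q.derivative.natDegree < q.natDegree := by
  have hdeg : q.natDegree ≠ 0 := by
    intro h
    rw [Polynomial.eq_C_of_natDegree_eq_zero h] at hroot hq
    simp at hroot
    simp [hroot] at hq
  exact ⟨fun h => hdeg (Polynomial.derivative_eq_zero.1 h),
    Polynomial.natDegree_derivative_lt hdeg⟩

/-- If all roots of `q` come from `K`, there are no roots inside a gap. -/
theorem eval_map_ne_zero_of_gap {i : K →+* R} (hi : StrictMono i) {q : K[X]} (hq : q ≠ 0)
    (hroots : ∀ x, (q.map i).eval x = 0 → x ∈ i.range) {z z' : K}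
    (hgap : ∀ w ∈ q.roots.toFinset, z < w → ¬ w < z') (y : R) (h1 : i z < y) (h2 : y < i z') :
    (q.map i).eval y ≠ 0 := by
  intro hy
  obtain ⟨w, rfl⟩ := hroots y hy
  rw [Polynomial.eval_map_apply, map_eq_zero] at hy
  exact hgap w (by simpa [hq] using hy) (hi.lt_iff_lt.1 h1) (hi.lt_iff_lt.1 h2)

/-- Polynomials of small degree all whose roots in `R` lie in `K` have all their roots in `S`
in `K`. -/
theorem roots_mem_range_of_natDegree_lt (hR : PolyIVT R) (hS : PolyIVT S) {i : K →+* R}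
    {e : K →+* S} (hi : StrictMono i) (he : StrictMono e) {d : ℕ}
    (hd : ∀ q : K[X], q ≠ 0 → q.natDegree < d → ∀ x, (q.map i).eval x = 0 → x ∈ i.range)
    (q : K[X]) (hq : q ≠ 0) (hqd : q.natDegree < d) (β : S) (hβ : (q.map e).eval β = 0) :
    β ∈ e.range := by
  induction hn : q.natDegree using Nat.strong_induction_on generalizing q β with
  | _ n ih =>
  subst hn
  by_contra hmem
  obtain ⟨hq'0, hq'd⟩ := derivative_ne_zero_of_eval_map_eq_zero hq hβ
  have hroots : ∀ x, (q.derivative.map e).eval x = 0 → x ∈ e.range :=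
    fun x hx => ih _ hq'd q.derivative hq'0 (hq'd.trans hqd) x hx rfl
  obtain ⟨z, z', hz, hz', hgap⟩ := exists_gap he hmem hq hβ q.derivative.roots.toFinset
  have hno : ∀ y, e z < y → y < e z' → (q.map e).derivative.eval y ≠ 0 := by
    rw [Polynomial.derivative_map]
    exact eval_map_ne_zero_of_gap he hq'0 hroots hgap
  have hneg := hS.eval_mul_eval_neg hz hz' hβ hno
  rw [Polynomial.eval_map_apply, Polynomial.eval_map_apply, ← map_mul, ← map_zero e,
    he.lt_iff_lt] at hneg
  obtain ⟨x, hx1, hx2, hx⟩ := hR (q.map i) (i z) (i z') (hi (he.lt_iff_lt.1 (hz.trans hz'))) (by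
    rw [Polynomial.eval_map_apply, Polynomial.eval_map_apply, ← map_mul, ← map_zero i]
    exact hi hneg)
  obtain ⟨w, rfl⟩ := hd q hq hqd x hx
  rw [hi.lt_iff_lt] at hx1 hx2
  rw [Polynomial.eval_map_apply, map_eq_zero] at hx
  have hw : (q.map e).eval (e w) = 0 := by rw [Polynomial.eval_map_apply, hx, map_zero]
  have hwβ : e w ≠ β := fun h => hmem ⟨w, h⟩
  rcases lt_or_gt_of_ne hwβ with h | h
  · obtain ⟨y, h1, h2, h3⟩ := hS.rolle h hw hβ
    exact hno y ((he hx1).trans h1) (h2.trans hz') h3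
  · obtain ⟨y, h1, h2, h3⟩ := hS.rolle h hβ hw
    exact hno y (hz.trans h1) (h2.trans (he hx2)) h3

theorem eval_map_mod {j : K →+* R} {f : K[X]} {x : R} (hx : (f.map j).eval x = 0) (g : K[X]) :
    (g.map j).eval x = ((g % f).map j).eval x := by
  conv_lhs => rw [← EuclideanDomain.div_add_mod g f]
  simp [hx]

/-- The heart of the Artin–Lang theorem: if every point of `R` that can be simulated in `S`
lies in `K`, then `K` is all of `R`. -/
theorem surjective_of_forall_simulated (hR : PolyIVT R) (hS : PolyIVT S) {i : K →+* R}
    {e : K →+* S} (hi : StrictMono i) (he : StrictMono e)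
    (hmax : ∀ α : R, (∀ G : Finset K[X], ∃ β : S, ∀ g ∈ G,
      SignType.sign ((g.map e).eval β) = SignType.sign ((g.map i).eval α)) → α ∈ i.range)
    (α : R) : α ∈ i.range := by
  have hclosed : ∀ d, ∀ q : K[X], q ≠ 0 → q.natDegree = d →
      ∀ x, (q.map i).eval x = 0 → x ∈ i.range := by
    intro d
    induction d using Nat.strong_induction_on with
    | _ d ih =>
    have hd : ∀ q : K[X], q ≠ 0 → q.natDegree < d → ∀ x, (q.map i).eval x = 0 → x ∈ i.range :=
      fun q hq hqd => ih _ hqd q hq rfl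
    have hd' := roots_mem_range_of_natDegree_lt hR hS hi he hd
    rintro f hf rfl α hα
    by_contra hmem
    obtain ⟨hf'0, hf'd⟩ := derivative_ne_zero_of_eval_map_eq_zero hf hα
    obtain ⟨z, z', hz, hz', hgap⟩ := exists_gap hi hmem hf hα f.derivative.roots.toFinset
    have hzz' : z < z' := hi.lt_iff_lt.1 (hz.trans hz')
    have hnoR : ∀ y, i z < y → y < i z' → (f.map i).derivative.eval y ≠ 0 := by
      rw [Polynomial.derivative_map]
      exact eval_map_ne_zero_of_gap hi hf'0 (hd _ hf'0 hf'd) hgap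
    have hnoS : ∀ y, e z < y → y < e z' → (f.map e).derivative.eval y ≠ 0 := by
      rw [Polynomial.derivative_map]
      exact eval_map_ne_zero_of_gap he hf'0 (hd' _ hf'0 hf'd) hgap
    have evR : ∀ a b, i a < α → α < i b → z ≤ a → b ≤ z' → f.eval a * f.eval b < 0 := by
      intro a b ha hb hza hbz
      have := hR.eval_mul_eval_neg ha hb hα fun y h1 h2 =>
        hnoR y ((hi.monotone hza).trans_lt h1) (h2.trans_le (hi.monotone hbz))
      rwa [Polynomial.eval_map_apply, Polynomial.eval_map_apply, ← map_mul, ← map_zero i,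
        hi.lt_iff_lt] at this
    have hneg := evR z z' hz hz' le_rfl le_rfl
    obtain ⟨β, hzβ, hβz', hβ⟩ := hS (f.map e) (e z) (e z') (he hzz') (by
      rw [Polynomial.eval_map_apply, Polynomial.eval_map_apply, ← map_mul, ← map_zero e]
      exact he hneg)
    have evS : ∀ a b, e a < β → β < e b → z ≤ a → b ≤ z' → f.eval a * f.eval b < 0 := by
      intro a b ha hb hza hbz
      have := hS.eval_mul_eval_neg ha hb hβ fun y h1 h2 =>
        hnoS y ((he.monotone hza).trans_lt h1) (h2.trans_le (he.monotone hbz))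
      rwa [Polynomial.eval_map_apply, Polynomial.eval_map_apply, ← map_mul, ← map_zero e,
        he.lt_iff_lt] at this
    have hβne : ∀ w, f.eval w ≠ 0 → e w ≠ β := by
      rintro w hw rfl
      rw [Polynomial.eval_map_apply, map_eq_zero] at hβ
      exact hw hβ
    have hcut1 : ∀ w, i w < α → e w < β := by
      intro w hw
      rcases le_or_gt w z with h | h
      · exact (he.monotone h).trans_lt hzβ
      have h1 := evR w z' hw hz' h.le le_rfl
      by_contra! h2
      have h3 := evS z w hzβ (lt_of_le_of_ne h2 (hβne w (left_ne_zero_of_mul h1.ne)).symm) le_rfl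
        (hi.lt_iff_lt.1 (hw.trans hz')).le
      nlinarith [mul_pos_of_neg_of_neg h1 h3, mul_self_nonneg (f.eval w)]
    have hcut2 : ∀ w, α < i w → β < e w := by
      intro w hw
      rcases le_or_gt z' w with h | h
      · exact hβz'.trans_le (he.monotone h)
      have h1 := evR z w hz hw le_rfl h.le
      by_contra! h2
      have h3 := evS w z' (lt_of_le_of_ne h2 (hβne w (right_ne_zero_of_mul h1.ne))) hβz'
        (hi.lt_iff_lt.1 (hz.trans hw)).le le_rfl
      nlinarith [mul_pos_of_neg_of_neg h1 h3, mul_self_nonneg (f.eval w)]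
    refine hmem (hmax α fun G => ⟨β, fun g _ => ?_⟩)
    rw [eval_map_mod hβ g, eval_map_mod hα g]
    rcases eq_or_ne (g % f) 0 with h0 | h0
    · simp [h0]
    have hdeg : (g % f).natDegree < f.natDegree :=
      Polynomial.natDegree_mod_lt g (by omega)
    obtain ⟨c, hc⟩ := exists_same_side hi hmem (g % f).roots.toFinset
    rw [hR.sign_eval_map_eq hi h0 (hd _ h0 hdeg) hc]
    exact hS.sign_eval_map_eq he h0 (hd' _ h0 hdeg) fun w hw =>
      ⟨(hc w hw).1, fun h => hcut1 w ((hc w hw).2.1 h), fun h => hcut2 w ((hc w hw).2.2 h)⟩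
  by_contra hmem
  refine hmem (hmax α fun G => ?_)
  obtain ⟨c, hc⟩ := exists_same_side hi hmem (G.biUnion fun g => g.roots.toFinset)
  refine ⟨e c, fun g hg => ?_⟩
  rw [Polynomial.eval_map_apply, he.sign_map]
  rcases eq_or_ne g 0 with rfl | hg0
  · simp
  · exact (hR.sign_eval_map_eq hi hg0 (hclosed _ g hg0 rfl)
      fun z hz => hc z (Finset.mem_biUnion.2 ⟨g, hg, hz⟩)).symm

end OrderedEmbedding

section Ultrapower

open Filter

variable {ι : Type*} {U : Ultrafilter ι}

theorem polyIVT_real : PolyIVT ℝ := by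
  intro q a b hab h
  have hc : ContinuousOn (fun x => q.eval x) (Set.Icc a b) := q.continuous.continuousOn
  rcases mul_neg_iff.1 h with ⟨h1, h2⟩ | ⟨h1, h2⟩
  · obtain ⟨x, hx, hx0⟩ := intermediate_value_Ioo' hab.le hc ⟨h2, h1⟩
    exact ⟨x, hx.1, hx.2, hx0⟩
  · obtain ⟨x, hx, hx0⟩ := intermediate_value_Ioo hab.le hc ⟨h1, h2⟩
    exact ⟨x, hx.1, hx.2, hx0⟩

theorem eventually_sign_eq_sign_germ (u : ι → ℝ) :
    ∀ᶠ s in (U : Filter ι), SignType.sign (u s) =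
      SignType.sign (Germ.coeRingHom (U : Filter ι) u) := by
  rcases lt_trichotomy (Germ.coeRingHom (U : Filter ι) u) 0 with h | h | h
  · filter_upwards [Germ.coe_lt.1 h] with s hs
    rw [sign_neg h, sign_neg hs]
  · filter_upwards [Germ.coe_eq.1 h] with s hs
    rw [h, hs]
    simp
  · filter_upwards [Germ.coe_lt.1 h] with s hs
    rw [sign_pos h, sign_pos hs]

theorem germ_coeRingHom_surjective :
    Function.Surjective (Germ.coeRingHom (U : Filter ι) (R := ℝ)) :=
  fun x => Germ.inductionOn x fun u => ⟨u, rfl⟩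

theorem polyIVT_germ : PolyIVT (Germ (U : Filter ι) ℝ) := by
  intro q a b hab h
  obtain ⟨Q, rfl⟩ := Polynomial.map_surjective _ germ_coeRingHom_surjective q
  obtain ⟨a, rfl⟩ := germ_coeRingHom_surjective a
  obtain ⟨b, rfl⟩ := germ_coeRingHom_surjective b
  have hev : ∀ (x : ι → ℝ) (s : ι),
      Q.eval x s = (Q.map (Pi.evalRingHom (fun _ : ι => ℝ) s)).eval (x s) :=
    fun x s => (Polynomial.eval_map_apply (f := Pi.evalRingHom (fun _ : ι => ℝ) s) (p := Q) x).symm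
  rw [Polynomial.eval_map_apply, Polynomial.eval_map_apply, ← map_mul] at h
  have hex : ∀ᶠ s in (U : Filter ι), ∃ x, a s < x ∧ x < b s ∧
      (Q.map (Pi.evalRingHom (fun _ : ι => ℝ) s)).eval x = 0 := by
    filter_upwards [Germ.coe_lt.1 hab, Germ.coe_lt.1 h] with s h1 h2
    refine polyIVT_real _ _ _ h1 ?_
    rwa [← hev, ← hev]
  obtain ⟨x, hx⟩ := Filter.skolem.1 hex
  refine ⟨Germ.coeRingHom _ x, Germ.coe_lt.2 (hx.mono fun s h => h.1),
    Germ.coe_lt.2 (hx.mono fun s h => h.2.1), ?_⟩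
  rw [Polynomial.eval_map_apply]
  refine Germ.coe_eq.2 (hx.mono fun s h => ?_)
  rw [hev, h.2.2]

end Ultrapower

section ArtinLang

set_option linter.unusedSectionVars false

open Filter

variable {R : Type*} [Field R] [LinearOrder R] [IsStrictOrderedRing R] [Algebra ℝ R]

/-- Every finite system of sign conditions over `ℝ` that holds at points of `K ⊆ R` holds at
real points as well. -/
def SignRealizable (K : Set R) : Prop :=
  ∀ P : Finset (MvPolynomial R ℝ), (∀ p ∈ P, p ∈ supported ℝ K) →
    ∃ s : R → ℝ, ∀ p ∈ P, SignType.sign (eval s p) = SignType.sign (aeval id p : R)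

theorem strictMono_algebraMap_real : StrictMono (algebraMap ℝ R) := by
  intro a b hab
  have h : 0 < Real.sqrt (b - a) := Real.sqrt_pos.2 (sub_pos.2 hab)
  rw [← sub_pos, ← map_sub, ← Real.mul_self_sqrt (sub_pos.2 hab).le, map_mul]
  exact mul_self_pos.2 (by simpa using h.ne')

theorem aeval_eq_aeval_of_supported {A : Type*} [CommRing A] [Algebra ℝ A] {K : Set R}
    {p : MvPolynomial R ℝ} (hp : p ∈ supported ℝ K) {u v : R → A} (h : ∀ r ∈ K, u r = v r) :
    aeval u p = aeval v p :=
  eval₂Hom_congr' rfl (fun r hr _ => h r (mem_supported.1 hp hr)) rfl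

theorem signRealizable_bot : SignRealizable ((⊥ : Subalgebra ℝ R) : Set R) := by
  intro P hP
  have hs : ∀ r : R, r ∈ ((⊥ : Subalgebra ℝ R) : Set R) → ∃ x : ℝ, algebraMap ℝ R x = r :=
    fun r hr => Algebra.mem_bot.1 hr
  choose! s hs using hs
  refine ⟨s, fun p hp => ?_⟩
  rw [← strictMono_algebraMap_real (R := R).sign_map,
    ← aeval_eq_aeval_of_supported (v := id) (hP p hp) hs]
  congr 1
  exact (aeval_algebraMap_apply (B := R) s p).symm

theorem exists_maximal_signRealizable :
    ∃ K : Subalgebra ℝ R, Maximal (fun K : Subalgebra ℝ R => SignRealizable (K : Set R)) K := by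
  obtain ⟨K, -, hK⟩ := zorn_le_nonempty₀ {K : Subalgebra ℝ R | SignRealizable (K : Set R)}
    (fun c hc hc' x hx => by
      refine ⟨sSup c, fun P hP => ?_, fun _ => le_sSup⟩
      have hfin : ∃ K ∈ c, ∀ r ∈ P.biUnion vars, r ∈ K := by
        have hmem : ∀ r ∈ P.biUnion vars, r ∈ sSup c := fun r hr => by
          obtain ⟨p, hp, hr⟩ := Finset.mem_biUnion.1 hr
          exact mem_supported.1 (hP p hp) hr
        generalize P.biUnion vars = T at hmem
        induction T using Finset.induction_on with
        | empty => exact ⟨x, hx, by simp⟩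
        | insert r T _ ih =>
          obtain ⟨E, hE, h1⟩ := ih fun y hy => hmem y (Finset.mem_insert_of_mem hy)
          have hr := hmem r (Finset.mem_insert_self _ _)
          have : Nonempty c := ⟨⟨x, hx⟩⟩
          rw [sSup_eq_iSup', ← SetLike.mem_coe, Subalgebra.coe_iSup_of_directed
            hc'.directedOn.directed_val, Set.mem_iUnion] at hr
          obtain ⟨⟨E', hE'⟩, h2⟩ := hr
          obtain ⟨E'', hE'', h3, h4⟩ := hc'.directedOn E hE E' hE'
          refine ⟨E'', hE'', fun y hy => ?_⟩
          rcases Finset.mem_insert.1 hy with rfl | hy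
          · exact h4 h2
          · exact h3 (h1 y hy)
      obtain ⟨K, hK, hr⟩ := hfin
      refine hc hK P fun p hp => mem_supported.2 fun r hrp => hr r ?_
      exact Finset.mem_biUnion.2 ⟨p, hp, hrp⟩) ⊥ signRealizable_bot
  exact ⟨K, hK⟩

theorem SignRealizable.exists_ultrafilter {K : Set R} (hK : SignRealizable K) :
    ∃ U : Ultrafilter (R → ℝ), ∀ p ∈ supported ℝ K, ∀ᶠ s in (U : Filter (R → ℝ)),
      SignType.sign (eval s p) = SignType.sign (aeval id p : R) := by
  obtain ⟨U, hU⟩ := Ultrafilter.exists_ultrafilter_of_finite_inter_nonempty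
    ((fun p => {s | SignType.sign (eval s p) = SignType.sign (aeval id p : R)}) ''
      (supported ℝ K : Set (MvPolynomial R ℝ))) fun T hT => by
        obtain ⟨P, hP, rfl⟩ := Finset.subset_set_image_iff.1 hT
        obtain ⟨s, hs⟩ := hK P fun p hp => hP hp
        exact ⟨s, by simpa using hs⟩
  exact ⟨U, fun p hp => hU ⟨p, hp, rfl⟩⟩

theorem SignRealizable.exists_ringHom {K : Subalgebra ℝ R} (hK : SignRealizable (K : Set R)) :
    ∃ (U : Ultrafilter (R → ℝ)) (e : K →+* Germ (U : Filter (R → ℝ)) ℝ),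
      (∀ x : ℝ, e (algebraMap ℝ K x) = Germ.coeRingHom _ fun _ => x) ∧
      ∀ a : K, SignType.sign (e a) = SignType.sign (a : R) := by
  obtain ⟨U, hU⟩ := hK.exists_ultrafilter
  have hX : ∀ a : K, X (a : R) ∈ supported ℝ (K : Set R) :=
    fun a => X_mem_supported.2 a.2
  have hzero : ∀ p ∈ supported ℝ (K : Set R), (aeval id p : R) = 0 →
      ∀ᶠ s in (U : Filter (R → ℝ)), eval s p = 0 := fun p hp h0 => by
    filter_upwards [hU p hp] with s hs
    rwa [h0, sign_zero, sign_eq_zero_iff] at hs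
  have hreal : ∀ x : ℝ, ∀ᶠ s in (U : Filter (R → ℝ)), s (algebraMap ℝ R x) = x := fun x => by
    filter_upwards [hzero (X (algebraMap ℝ R x) - C x)
      (sub_mem (hX (algebraMap ℝ K x)) (Subalgebra.algebraMap_mem _ x)) (by simp)] with s hs
    simpa [sub_eq_zero] using hs
  refine ⟨U,
    { toFun := fun a => Germ.coeRingHom (U : Filter (R → ℝ)) fun s => s a
      map_one' := Germ.coe_eq.2 ?_
      map_zero' := Germ.coe_eq.2 ?_
      map_add' := fun a b => Germ.coe_eq.2 ?_
      map_mul' := fun a b => Germ.coe_eq.2 ?_ }, fun x => Germ.coe_eq.2 (hreal x), fun a => ?_⟩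
  · filter_upwards [hreal 1] with s hs
    simpa using hs
  · filter_upwards [hzero (X ((a * b : K) : R) - X (a : R) * X (b : R))
      (sub_mem (hX _) (mul_mem (hX _) (hX _))) (by simp)] with s hs
    simpa [sub_eq_zero] using hs
  · filter_upwards [hreal 0] with s hs
    simpa using hs
  · filter_upwards [hzero (X ((a + b : K) : R) - (X (a : R) + X (b : R)))
      (sub_mem (hX _) (add_mem (hX _) (hX _))) (by simp)] with s hs
    simpa [sub_eq_zero] using hs
  · obtain ⟨s, h1, h2⟩ := ((hU _ (hX a)).and
      (eventually_sign_eq_sign_germ (U := U) fun s : R → ℝ => s a)).exists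
    change SignType.sign (Germ.coeRingHom (U : Filter (R → ℝ)) fun s => s a) = _
    rw [← h2]
    simpa using h1

theorem mem_of_maximal_signRealizable {K : Subalgebra ℝ R}
    (hK : Maximal (fun K : Subalgebra ℝ R => SignRealizable (K : Set R)) K)
    {U : Ultrafilter (R → ℝ)} {e : K →+* Germ (U : Filter (R → ℝ)) ℝ}
    (he : ∀ x : ℝ, e (algebraMap ℝ K x) = Germ.coeRingHom _ fun _ => x) {α : R}
    (hα : ∀ G : Finset K[X], ∃ β, ∀ g ∈ G,
      SignType.sign ((g.map e).eval β) = SignType.sign ((g.map (algebraMap K R)).eval α)) :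
    α ∈ K := by
  let L : Subalgebra ℝ R := (Polynomial.aeval (R := K) α).range.restrictScalars ℝ
  have hL : SignRealizable (L : Set R) := by
    intro P hP
    have hg : ∀ r ∈ (L : Set R), ∃ g : K[X], Polynomial.aeval α g = r := fun r hr => hr
    choose! g hg using hg
    obtain ⟨β, hβ⟩ := hα (P.image (aeval g))
    have ht : ∀ r : R, ∃ t : (R → ℝ) → ℝ,
        Germ.coeRingHom (U : Filter (R → ℝ)) t = ((g r).map e).eval β :=
      fun r => germ_coeRingHom_surjective _
    choose t ht using ht
    let c : ℝ →+* ((R → ℝ) → ℝ) := Pi.constRingHom _ _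
    have hcomp : ((Polynomial.evalRingHom β).comp (Polynomial.mapRingHom e)).comp
        (aeval g : MvPolynomial R ℝ →ₐ[ℝ] K[X]).toRingHom =
        (Germ.coeRingHom (U : Filter (R → ℝ))).comp (eval₂Hom c t) := by
      refine MvPolynomial.ringHom_ext (fun x => ?_) fun r => ?_
      · simp [c, Polynomial.algebraMap_apply, he]
        rfl
      · simp [ht]
    have hev : ∀ p, ∀ s, eval₂Hom c t p s = eval (fun r => t r s) p := by
      intro p s
      have : (Pi.evalRingHom (fun _ => ℝ) s).comp (eval₂Hom c t) = eval (fun r => t r s) :=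
        MvPolynomial.ringHom_ext (fun x => by simp [c]) fun r => by simp
      exact RingHom.congr_fun this p
    have hall : ∀ᶠ s in (U : Filter (R → ℝ)), ∀ p ∈ P,
        SignType.sign (eval (fun r => t r s) p) = SignType.sign (aeval id p : R) := by
      refine (Filter.eventually_all_finset P).2 fun p hp => ?_
      filter_upwards [eventually_sign_eq_sign_germ (U := U) (eval₂Hom c t p)] with s hs
      have h1 := hβ (aeval g p) (Finset.mem_image_of_mem _ hp)
      have h2 : ((aeval g p).map e).eval β =
          Germ.coeRingHom (U : Filter (R → ℝ)) (eval₂Hom c t p) := RingHom.congr_fun hcomp p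
      have h3 : ((aeval g p).map (algebraMap K R)).eval α = aeval id p := by
        rw [Polynomial.eval_map_algebraMap, ← aeval_eq_aeval_of_supported (v := id) (hP p hp) hg]
        exact (MvPolynomial.comp_aeval_apply g
          ((Polynomial.aeval (R := K) α).restrictScalars ℝ) p)
      rw [← hev, hs, ← h2, h1, h3]
    obtain ⟨s, hs⟩ := hall.exists
    exact ⟨fun r => t r s, hs⟩
  have hKL : K ≤ L := fun r hr => ⟨Polynomial.C ⟨r, hr⟩, by simp⟩
  exact hK.2 hL hKL ⟨Polynomial.X, by simp⟩

theorem sign_eval_map_inv {K T : Type*} [CommRing K] [Field T] [LinearOrder T]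
    [IsStrictOrderedRing T] (j : K →+* T) {b : K} (hb : j b ≠ 0) (g : K[X]) :
    SignType.sign ((g.map j).eval (j b)⁻¹) =
      SignType.sign (j (g.reverse.eval b * b ^ g.natDegree)) := by
  let : Invertible (j b)⁻¹ := invertibleOfNonzero (inv_ne_zero hb)
  have h := Polynomial.eval₂_reverse_mul_pow j (j b)⁻¹ g
  rw [invOf_eq_inv, inv_inv, Polynomial.eval₂_at_apply] at h
  rw [Polynomial.eval_map, ← h]
  have : j (g.reverse.eval b * b ^ g.natDegree) =
      j (g.reverse.eval b) * (j b)⁻¹ ^ g.natDegree * (j b ^ g.natDegree) ^ 2 := by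
    rw [map_mul, map_pow, inv_pow]
    field_simp
  have hpos : 0 < (j b ^ g.natDegree) ^ 2 := by positivity
  rw [this, sign_mul _ ((j b ^ g.natDegree) ^ 2), sign_pos hpos, mul_one]

/-- The Artin–Lang theorem: finite systems of sign conditions over `ℝ` which are solvable in `R`
are solvable in `ℝ`. -/
theorem PolyIVT.signRealizable_univ (hR : PolyIVT R) : SignRealizable (Set.univ : Set R) := by
  obtain ⟨K, hK⟩ := exists_maximal_signRealizable (R := R)
  obtain ⟨U, e, he, hsign⟩ := hK.1.exists_ringHom
  have hmem : ∀ α : R, (∀ G : Finset K[X], ∃ β, ∀ g ∈ G, SignType.sign ((g.map e).eval β) =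
      SignType.sign ((g.map (algebraMap K R)).eval α)) → α ∈ K :=
    fun α => mem_of_maximal_signRealizable hK he
  have hfield : IsField K := by
    refine ⟨⟨0, 1, zero_ne_one⟩, mul_comm, fun {b} hb => ?_⟩
    have hb1 : algebraMap K R b ≠ 0 := by simpa using hb
    have hb2 : e b ≠ 0 := by
      rw [← sign_ne_zero, hsign, sign_ne_zero]
      exact hb1
    have hinv : (algebraMap K R b)⁻¹ ∈ K := hmem _ fun G => ⟨(e b)⁻¹, fun g _ => by
      rw [sign_eval_map_inv e hb2, sign_eval_map_inv _ hb1, hsign]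
      rfl⟩
    exact ⟨⟨_, hinv⟩, Subtype.ext (mul_inv_cancel₀ hb1)⟩
  have hmono : StrictMono e := by
    intro a b hab
    rw [← sub_pos, ← map_sub, ← sign_eq_one_iff, hsign, sign_eq_one_iff]
    exact sub_pos.2 hab
  have htop : ∀ α : R, α ∈ K := by
    let : Field K := hfield.toField
    intro α
    obtain ⟨a, rfl⟩ := surjective_of_forall_simulated hR polyIVT_germ (i := algebraMap K R)
      (fun a b hab => hab) hmono (fun α hα => ⟨⟨α, hmem α hα⟩, rfl⟩) α
    exact a.2
  intro P hP
  exact hK.1 P fun p _ => mem_supported.2 fun r _ => htop r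

theorem PolyIVT.exists_real_point (hR : PolyIVT R) {ι κ : Type*} [Finite κ]
    (p : κ → MvPolynomial ι ℝ) (x : ι → R) :
    ∃ y : ι → ℝ, ∀ k, SignType.sign (eval y (p k)) = SignType.sign (aeval x (p k)) := by
  classical
  have := Fintype.ofFinite κ
  obtain ⟨s, hs⟩ := hR.signRealizable_univ (Finset.univ.image fun k => rename x (p k))
    (by simp [supported_univ])
  refine ⟨s ∘ x, fun k => ?_⟩
  have := hs (rename x (p k)) (by simp)
  rwa [eval_rename, aeval_rename, Function.id_comp] at this

end ArtinLang

section SumsOfSquares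

variable {n : ℕ}

theorem IsSOS.zero : IsSOS (0 : MvPolynomial (Fin n) ℝ) := ⟨0, Fin.elim0, by simp⟩

theorem IsSOS.sq (q : MvPolynomial (Fin n) ℝ) : IsSOS (q ^ 2) := ⟨1, fun _ => q, by simp⟩

theorem IsSOS.add {p q : MvPolynomial (Fin n) ℝ} (hp : IsSOS p) (hq : IsSOS q) :
    IsSOS (p + q) := by
  obtain ⟨a, u, rfl⟩ := hp
  obtain ⟨b, v, rfl⟩ := hq
  exact ⟨a + b, Fin.append u v, by simp [Fin.sum_univ_add]⟩

theorem IsSOS.sq_mul {p : MvPolynomial (Fin n) ℝ} (hp : IsSOS p) (q : MvPolynomial (Fin n) ℝ) :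
    IsSOS (q ^ 2 * p) := by
  obtain ⟨a, u, rfl⟩ := hp
  exact ⟨a, fun i => q * u i, by simp [Finset.mul_sum, mul_pow]⟩

theorem IsSOS.eval_nonneg {p : MvPolynomial (Fin n) ℝ} (hp : IsSOS p) (x : Fin n → ℝ) :
    0 ≤ eval x p := by
  obtain ⟨a, u, rfl⟩ := hp
  rw [map_sum]
  exact Finset.sum_nonneg fun i _ => by rw [map_pow]; exact sq_nonneg _

theorem IsSumSq.isSOS {p : MvPolynomial (Fin n) ℝ} (hp : IsSumSq p) : IsSOS p := by
  induction hp with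
  | zero => exact .zero
  | sq_add a _ ih =>
    rw [← _root_.sq]
    exact (IsSOS.sq a).add ih

/-- The real Nullstellensatz. -/
theorem exists_pow_add_mem_span_of_forall_eval_eq_zero {m : ℕ}
    (h : Fin m → MvPolynomial (Fin n) ℝ) {p : MvPolynomial (Fin n) ℝ}
    (hp : p ∈ vanishIdeal (realVariety h)) :
    ∃ l σ, IsSOS σ ∧ p ^ (2 * l) + σ ∈ Ideal.span (Set.range h) := by
  by_contra! hcon
  have hdisj : Disjoint (Ideal.span (Set.range h) : Set (MvPolynomial (Fin n) ℝ))
      (evenPowAddSumSq p) := by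
    refine Set.disjoint_right.2 ?_
    rintro _ ⟨l, σ, hσ, rfl⟩
    exact hcon l σ hσ.isSOS
  obtain ⟨R, _, _, _, φ, hR, hI, hφp⟩ := Ideal.exists_ringHom_polyIVT _ p hdisj
  let : Algebra ℝ R := (φ.comp C).toAlgebra
  have hφ : ∀ q, aeval (fun i => φ (X i)) q = φ q := fun q => by
    have : (aeval (fun i => φ (X i)) : MvPolynomial (Fin n) ℝ →ₐ[ℝ] R).toRingHom = φ :=
      MvPolynomial.ringHom_ext (fun x => by simp [RingHom.algebraMap_toAlgebra]) fun i => by simp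
    exact RingHom.congr_fun this q
  obtain ⟨y, hy⟩ := hR.exists_real_point (fun k : Option (Fin m) => k.elim p h)
    fun i => φ (X i)
  have hp0 := hy none
  rw [Option.elim_none, hφ, hp y fun i => ?_, sign_zero] at hp0
  · exact hφp (sign_eq_zero_iff.1 hp0.symm)
  · have := hy (some i)
    rwa [Option.elim_some, hφ, hI _ (Ideal.subset_span ⟨i, rfl⟩), sign_zero,
      sign_eq_zero_iff] at this

/-- Adding a positive constant makes a polynomial a sum of squares up to a multiple of a high
power of it, with degrees that do not depend on the constant. -/
theorem exists_add_C_eq_isSOS_sub (m : ℕ) (u : MvPolynomial (Fin n) ℝ) {ε : ℝ} (hε : 0 < ε) :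
    ∃ (c : ℝ) (s : MvPolynomial (Fin n) ℝ), 0 ≤ c ∧ IsSOS s ∧
      s.totalDegree ≤ 2 ^ (m + 1) * u.totalDegree ∧
      u + C ε = s - C c * u ^ 2 ^ (m + 1) := by
  have hdeg : ∀ (a b : ℝ) (v : MvPolynomial (Fin n) ℝ),
      ((C a * v + C b) ^ 2).totalDegree ≤ 2 * v.totalDegree := by
    intro a b v
    refine (totalDegree_pow _ _).trans (Nat.mul_le_mul_left _ ?_)
    refine (totalDegree_add _ _).trans (max_le ?_ (by simp))
    exact (totalDegree_mul _ _).trans (by simp)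
  have hC : ∀ a : ℝ, a ≠ 0 → (C a : MvPolynomial (Fin n) ℝ) * C a⁻¹ = 1 := fun a ha => by
    rw [← C_mul, mul_inv_cancel₀ ha, C_1]
  induction m generalizing ε with
  | zero =>
    obtain ⟨b, hb, rfl⟩ : ∃ b : ℝ, 0 < b ∧ b ^ 2 = ε :=
      ⟨√ε, Real.sqrt_pos.2 hε, Real.sq_sqrt hε.le⟩
    refine ⟨(2⁻¹ * b⁻¹) ^ 2, (C (2⁻¹ * b⁻¹) * u + C b) ^ 2, by positivity, .sq _, hdeg _ _ _, ?_⟩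
    have h2 := hC 2 two_ne_zero
    simp only [C_mul, C_pow, map_ofNat] at h2 ⊢
    linear_combination (-u) * hC b hb.ne' - u * C b * C b⁻¹ * h2
  | succ m ih =>
    obtain ⟨c, s, hc, hs, hsd, hu⟩ := ih (half_pos hε)
    obtain ⟨b, hb, hb2⟩ : ∃ b : ℝ, 0 < b ∧ b ^ 2 = ε / 2 :=
      ⟨√(ε / 2), Real.sqrt_pos.2 (half_pos hε), Real.sq_sqrt (half_pos hε).le⟩
    set v := u ^ 2 ^ (m + 1) with hv
    have hvd : v.totalDegree ≤ 2 ^ (m + 1) * u.totalDegree := totalDegree_pow _ _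
    have hpow : u ^ 2 ^ (m + 1 + 1) = v ^ 2 := by rw [hv, ← pow_mul, ← pow_succ]
    refine ⟨(2⁻¹ * b⁻¹ * c) ^ 2, s + (C (-(2⁻¹ * b⁻¹ * c)) * v + C b) ^ 2, by positivity,
      hs.add (.sq _), ?_, ?_⟩
    · have := hdeg (-(2⁻¹ * b⁻¹ * c)) b v
      refine (totalDegree_add _ _).trans (max_le ?_ ?_)
      · exact hsd.trans (Nat.mul_le_mul_right _ (Nat.pow_le_pow_right two_pos (by omega)))
      · rw [pow_succ 2 (m + 1)]
        linarith
    · have h2 := hC 2 two_ne_zero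
      have hε2 : (C ε : MvPolynomial (Fin n) ℝ) = C (ε / 2) + C b ^ 2 := by
        rw [← C_pow, hb2, ← C_add, add_halves]
      rw [hpow, hε2, ← add_assoc, hu]
      simp only [C_mul, C_pow, C_neg, map_ofNat] at h2 ⊢
      linear_combination (C c * v) * hC b hb.ne' + C c * v * C b * C b⁻¹ * h2

end SumsOfSquares

section Lasserre

variable {n m₁ m₂ : ℕ} {h : Fin m₁ → MvPolynomial (Fin n) ℝ} {g : Fin m₂ → MvPolynomial (Fin n) ℝ}

theorem truncIdeal_add {k : ℕ} {p q : MvPolynomial (Fin n) ℝ} (hp : p ∈ truncIdeal h k)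
    (hq : q ∈ truncIdeal h k) : p + q ∈ truncIdeal h k := by
  obtain ⟨φ, hφ, rfl⟩ := hp
  obtain ⟨ψ, hψ, rfl⟩ := hq
  refine ⟨φ + ψ, fun i => ?_, by simp [add_mul, Finset.sum_add_distrib]⟩
  rw [Pi.add_apply, add_mul]
  exact (totalDegree_add _ _).trans (max_le (hφ i) (hψ i))

theorem zero_mem_truncIdeal (k : ℕ) : (0 : MvPolynomial (Fin n) ℝ) ∈ truncIdeal h k :=
  ⟨0, by simp, by simp⟩

theorem truncIdeal_mono {k k' : ℕ} (hk : k ≤ k') : truncIdeal h k ⊆ truncIdeal h k' := by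
  rintro _ ⟨φ, hφ, rfl⟩
  exact ⟨φ, fun i => (hφ i).trans (by omega), rfl⟩

theorem truncQM_add {k : ℕ} {p q : MvPolynomial (Fin n) ℝ} (hp : p ∈ truncQM g k)
    (hq : q ∈ truncQM g k) : p + q ∈ truncQM g k := by
  obtain ⟨φ, hφ, rfl⟩ := hp
  obtain ⟨ψ, hψ, rfl⟩ := hq
  refine ⟨φ + ψ, fun i => ⟨(hφ i).1.add (hψ i).1, ?_⟩, by simp [add_mul, Finset.sum_add_distrib]⟩
  rw [Pi.add_apply, add_mul]
  exact (totalDegree_add _ _).trans (max_le (hφ i).2 (hψ i).2)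

theorem truncQM_mono {k k' : ℕ} (hk : k ≤ k') : truncQM g k ⊆ truncQM g k' := by
  rintro _ ⟨φ, hφ, rfl⟩
  exact ⟨φ, fun i => ⟨(hφ i).1, (hφ i).2.trans (by omega)⟩, rfl⟩

theorem IsSOS.mem_truncQM {k : ℕ} {σ : MvPolynomial (Fin n) ℝ} (hσ : IsSOS σ)
    (hk : σ.totalDegree ≤ 2 * k) : σ ∈ truncQM g k := by
  refine ⟨Fin.cons σ fun _ => 0, fun j => ?_, by simp [Fin.sum_univ_succ]⟩
  refine Fin.cases ?_ (fun j => ?_) j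
  · simpa using ⟨hσ, hk⟩
  · simpa using IsSOS.zero

theorem truncIdeal_add_truncQM_mono {k k' : ℕ} (hk : k ≤ k') :
    truncIdeal h k + truncQM g k ⊆ truncIdeal h k' + truncQM g k' :=
  Set.add_subset_add (truncIdeal_mono hk) (truncQM_mono hk)

theorem add_mem_truncIdeal_add_truncQM {k : ℕ} {p q : MvPolynomial (Fin n) ℝ}
    (hp : p ∈ truncIdeal h k + truncQM g k) (hq : q ∈ truncIdeal h k + truncQM g k) :
    p + q ∈ truncIdeal h k + truncQM g k := by
  obtain ⟨a, ha, b, hb, rfl⟩ := Set.mem_add.1 hp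
  obtain ⟨c, hc, d, hd, rfl⟩ := Set.mem_add.1 hq
  exact Set.mem_add.2 ⟨a + c, truncIdeal_add ha hc, b + d, truncQM_add hb hd, by ring⟩

theorem mem_truncIdeal_add_truncQM_of_mem_truncQM {k : ℕ} {p : MvPolynomial (Fin n) ℝ}
    (hp : p ∈ truncQM g k) : p ∈ truncIdeal h k + truncQM g k :=
  Set.mem_add.2 ⟨0, zero_mem_truncIdeal k, p, hp, zero_add p⟩

theorem exists_pow_two_pow_add_mem {I : Ideal (MvPolynomial (Fin n) ℝ)}
    {p : MvPolynomial (Fin n) ℝ} (hp : ∃ l σ, IsSOS σ ∧ p ^ (2 * l) + σ ∈ I) :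
    ∃ m σ, IsSOS σ ∧ p ^ 2 ^ (m + 1) + σ ∈ I := by
  obtain ⟨l, σ, hσ, hI⟩ := hp
  refine ⟨l, (p ^ (2 ^ l - l)) ^ 2 * σ, hσ.sq_mul _, ?_⟩
  have hl : l < 2 ^ l := Nat.lt_two_pow_self
  have : p ^ 2 ^ (l + 1) + (p ^ (2 ^ l - l)) ^ 2 * σ =
      (p ^ (2 ^ l - l)) ^ 2 * (p ^ (2 * l) + σ) := by
    rw [mul_add, ← pow_mul, ← pow_add]
    congr 2
    rw [pow_succ]
    omega
  rw [this]
  exact I.mul_mem_left _ hI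

/-- Bounded-degree multiples of an element `p` of the real radical of `⟨h⟩` become members of a
fixed level of the hierarchy after adding an arbitrarily small positive constant. -/
theorem exists_level_mul_add_C_mem {p : MvPolynomial (Fin n) ℝ}
    (hp : ∃ l σ, IsSOS σ ∧ p ^ (2 * l) + σ ∈ Ideal.span (Set.range h)) (D : ℕ) :
    ∃ k, ∀ φ : MvPolynomial (Fin n) ℝ, φ.totalDegree ≤ D → ∀ ε : ℝ, 0 < ε →
      φ * p + C ε ∈ truncIdeal h k + truncQM g k := by
  obtain ⟨m, σ, hσ, hI⟩ := exists_pow_two_pow_add_mem hp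
  obtain ⟨ψ, hψ⟩ := (Ideal.mem_span_range_iff_exists_fun).1 hI
  set N := 2 ^ (m + 1) with hN
  refine ⟨N * (D + p.totalDegree) + σ.totalDegree + ∑ i, (ψ i * h i).totalDegree,
    fun φ hφ ε hε => ?_⟩
  obtain ⟨c, s, hc, hs, hsd, hu⟩ := exists_add_C_eq_isSOS_sub m (φ * p) hε
  have hφN : (φ ^ N).totalDegree ≤ N * D :=
    (totalDegree_pow _ _).trans (Nat.mul_le_mul_left _ hφ)
  have hcφ : (C c * φ ^ N).totalDegree ≤ N * D :=
    (totalDegree_mul _ _).trans (by simpa using hφN)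
  have hND : N * (D + p.totalDegree) = N * D + N * p.totalDegree := mul_add _ _ _
  refine Set.mem_add.2 ⟨∑ i, -(C c * φ ^ N * ψ i) * h i, ⟨_, fun i => ?_, rfl⟩,
    s + C c * φ ^ N * σ, truncQM_add (hs.mem_truncQM ?_) (IsSOS.mem_truncQM ?_ ?_), ?_⟩
  · rw [neg_mul, totalDegree_neg, mul_assoc]
    refine (totalDegree_mul _ _).trans ?_
    have := Finset.single_le_sum (f := fun i => (ψ i * h i).totalDegree)
      (fun i _ => Nat.zero_le _) (Finset.mem_univ i)
    omega
  · have h1 : (φ * p).totalDegree ≤ D + p.totalDegree :=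
      (totalDegree_mul _ _).trans (by omega)
    have h2 := Nat.mul_le_mul_left N h1
    rw [← hN] at hsd
    omega
  · have : C c * φ ^ N * σ = (C √c * φ ^ 2 ^ m) ^ 2 * σ := by
      rw [mul_pow, ← C_pow, Real.sq_sqrt hc, ← pow_mul, hN, pow_succ]
    rw [this]
    exact hσ.sq_mul _
  · refine (totalDegree_mul _ _).trans ?_
    omega
  · rw [hu, mul_pow]
    have : ∑ i, -(C c * φ ^ N * ψ i) * h i = -(C c * φ ^ N) * ∑ i, ψ i * h i := by
      rw [Finset.mul_sum]
      exact Finset.sum_congr rfl fun i _ => by ring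
    rw [this, hψ]
    ring

theorem lasserreBound_mono (f : MvPolynomial (Fin n) ℝ) {k k' : ℕ} (hk : k ≤ k') :
    lasserreBound f h g k ≤ lasserreBound f h g k' :=
  sSup_le_sSup fun _ ⟨r, hr, hm⟩ => ⟨r, hr, truncIdeal_add_truncQM_mono hk hm⟩

theorem lasserreBound_le {f : MvPolynomial (Fin n) ℝ} {S : Set (Fin n → ℝ)} {fm : ℝ}
    (hfm : IsGLB ((fun x => eval x f) '' S) fm) (hS : S ⊆ feasSet h g) (k : ℕ) :
    lasserreBound f h g k ≤ fm := by
  refine sSup_le ?_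
  rintro _ ⟨r, rfl, hr⟩
  refine EReal.coe_le_coe_iff.2 (hfm.2 ?_)
  rintro _ ⟨x, hx, rfl⟩
  obtain ⟨hxh, hxg⟩ := hS hx
  obtain ⟨_, ⟨φ, -, rfl⟩, _, ⟨σ, hσ, rfl⟩, hsum⟩ := Set.mem_add.1 hr
  have := congrArg (eval x) hsum
  simp only [map_add, map_sum, map_mul, hxh, mul_zero, Finset.sum_const_zero, zero_add, map_sub,
    eval_C] at this
  have hnn : 0 ≤ ∑ j, eval x (σ j) *
      eval x ((Fin.cons 1 g : Fin (m₂ + 1) → MvPolynomial (Fin n) ℝ) j) := by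
    refine Finset.sum_nonneg fun j _ => mul_nonneg ((hσ j).1.eval_nonneg x) ?_
    refine Fin.cases ?_ (fun j => ?_) j
    · simp
    · simpa using hxg j
  dsimp only
  linarith

/-- If every generator of `⟨h⟩` can be replaced at a fixed level up to small constants, every
level of the hierarchy for `h` is dominated by a level of the hierarchy for `h'`. -/
theorem exists_lasserreBound_le {t : ℕ} {h' : Fin t → MvPolynomial (Fin n) ℝ}
    (f : MvPolynomial (Fin n) ℝ)
    (H : ∀ i, ∃ l σ, IsSOS σ ∧ h i ^ (2 * l) + σ ∈ Ideal.span (Set.range h')) (k : ℕ) :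
    ∃ k', lasserreBound f h g k ≤ lasserreBound f h' g k' := by
  choose κ hκ using fun i => exists_level_mul_add_C_mem (g := g) (H i) (2 * k)
  let k' := k + ∑ i, κ i
  have hκk : ∀ i, κ i ≤ k' := fun i =>
    (Finset.single_le_sum (fun i _ => Nat.zero_le _) (Finset.mem_univ i)).trans
      (Nat.le_add_left _ _)
  refine ⟨k', sSup_le ?_⟩
  rintro _ ⟨r, rfl, hr⟩
  refine EReal.ge_of_forall_gt_iff_ge.1 fun z hz => le_sSup ⟨z, rfl, ?_⟩
  have hδ : 0 < (r - z) / (m₁ + 1) := div_pos (sub_pos.2 (EReal.coe_lt_coe_iff.1 hz)) (by positivity)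
  obtain ⟨_, ⟨φ, hφ, rfl⟩, τ, hτ, hsum⟩ := Set.mem_add.1 hr
  have hsplit : f - C z = ∑ i, (φ i * h i + C ((r - z) / (m₁ + 1))) +
      (C ((r - z) / (m₁ + 1)) + τ) := by
    have hC : C r - C z = (m₁ : MvPolynomial (Fin n) ℝ) * C ((r - z) / (m₁ + 1)) +
        C ((r - z) / (m₁ + 1)) := by
      rw [← C_sub, ← map_natCast C m₁, ← C_mul, ← C_add]
      congr 1
      field_simp
    rw [Finset.sum_add_distrib, Finset.sum_const, Finset.card_univ, Fintype.card_fin,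
      nsmul_eq_mul]
    linear_combination hC - hsum
  rw [hsplit]
  refine add_mem_truncIdeal_add_truncQM (Finset.sum_induction _
    (· ∈ truncIdeal h' k' + truncQM g k') (fun _ _ => add_mem_truncIdeal_add_truncQM)
    (mem_truncIdeal_add_truncQM_of_mem_truncQM (IsSOS.zero.mem_truncQM (by simp))) fun i _ => ?_)
    (mem_truncIdeal_add_truncQM_of_mem_truncQM (truncQM_add (IsSOS.mem_truncQM ?_ (by simp))
      (truncQM_mono (Nat.le_add_right _ _) hτ)))
  · refine truncIdeal_add_truncQM_mono (hκk i) ?_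
    rcases eq_or_ne (h i) 0 with h0 | h0
    · simpa [h0] using hκ i 0 (by simp) _ hδ
    refine hκ i (φ i) ?_ _ hδ
    rcases eq_or_ne (φ i) 0 with hφ0 | hφ0
    · simp [hφ0]
    · have := hφ i
      rw [totalDegree_mul_of_isDomain hφ0 h0] at this
      omega
  · rw [← Real.sq_sqrt hδ.le, C_pow]
    exact .sq _

theorem finite_convergence_of_finite_convergence {t : ℕ} {h' : Fin t → MvPolynomial (Fin n) ℝ}
    {f : MvPolynomial (Fin n) ℝ} {S : Set (Fin n → ℝ)} {fm : ℝ}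
    (hfm : IsGLB ((fun x => eval x f) '' S) fm) (hS : S ⊆ feasSet h' g)
    (H : ∀ i, ∃ l σ, IsSOS σ ∧ h i ^ (2 * l) + σ ∈ Ideal.span (Set.range h'))
    (hconv : ∃ N : ℕ, ∀ k ≥ N, lasserreBound f h g k = (fm : EReal)) :
    ∃ N : ℕ, ∀ k ≥ N, lasserreBound f h' g k = (fm : EReal) := by
  obtain ⟨N, hN⟩ := hconv
  obtain ⟨k', hk'⟩ := exists_lasserreBound_le (g := g) f H N
  refine ⟨k', fun k hk => le_antisymm (lasserreBound_le hfm hS k) ?_⟩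
  rw [← hN N le_rfl]
  exact hk'.trans (lasserreBound_mono f hk)

end Lasserre

/-- If `f_min` is finite and `⟨h^{rad}⟩ = I(V_ℝ(h)) = I(K)`, then Lasserre's
hierarchy using `h` has finite convergence to `f_min` iff the one using
`h^{rad}` does. -/
theorem lasserre_finite_convergence_iff_radical
    {n m₁ m₂ t : ℕ} (f : MvPolynomial (Fin n) ℝ)
    (h : Fin m₁ → MvPolynomial (Fin n) ℝ) (g : Fin m₂ → MvPolynomial (Fin n) ℝ)
    (hrad : Fin t → MvPolynomial (Fin n) ℝ)
    (fm : ℝ) (hfm : IsGLB ((fun x => eval x f) '' feasSet h g) fm)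
    (hspan : (Ideal.span (Set.range hrad) : Set (MvPolynomial (Fin n) ℝ)) =
      vanishIdeal (realVariety h))
    (hIK : vanishIdeal (realVariety h) = vanishIdeal (feasSet h g)) :
    (∃ N : ℕ, ∀ k ≥ N, lasserreBound f h g k = (fm : EReal)) ↔
      (∃ N : ℕ, ∀ k ≥ N, lasserreBound f hrad g k = (fm : EReal)) := by
  have hmem : ∀ p, p ∈ Ideal.span (Set.range hrad) ↔ p ∈ vanishIdeal (realVariety h) :=
    fun p => Set.ext_iff.1 hspan p
  constructor
  · refine finite_convergence_of_finite_convergence hfm (fun x hx => ⟨fun j => ?_, hx.2⟩)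
      fun i => ⟨1, 0, .zero, ?_⟩
    · exact (hmem _).1 (Ideal.subset_span ⟨j, rfl⟩) x hx.1
    · rw [add_zero]
      exact Ideal.pow_mem_of_mem _ ((hmem _).2 fun x hx => hx i) _ two_pos
  · exact finite_convergence_of_finite_convergence hfm subset_rfl fun j =>
      exists_pow_add_mem_span_of_forall_eval_eq_zero h ((hmem _).1 (Ideal.subset_span ⟨j, rfl⟩))
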